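/- Let n be a positive integer with n ≡ 1 (mod 6), H a finite abelian group of order n²+n+1, and T₀, T₁ inverse-closed subsets of H with e ∈ T₀ and |T₀| + |T₁| = 2n+1 satisfying the APLL group-ring equations. Then T₁ ∩ {t³ : t ∈ T₀} = ∅, θ₀ = 0, and Δ₀ ⊆ T₁, where Δ₀ = {h ∈ H : #{t ∈ T₀ : t³ = h} = 2}. -/

import Mathlib

open scoped Classical Pointwise

/-- The APLL group-ring equations, stated via coefficient counts: for every `h ∈ H`,
`#{(a,b) ∈ T₀×T₁ : ab = h} = 1 − [h = e]`, and
`#{(a,b) ∈ T₀×T₀ : ab = h} + #{(a,b) ∈ T₁×T₁ : ab = h} + #{t ∈ T₀ : t² = h}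
  + #{t ∈ T₁ : t² = h} = 2 + 2n·[h = e]`. -/
def APLLEqs {H : Type*} [CommGroup H] (n : ℕ) (T₀ T₁ : Set H) : Prop :=
  (∀ h : H,
      {p : H × H | p.1 ∈ T₀ ∧ p.2 ∈ T₁ ∧ p.1 * p.2 = h}.ncard
        = if h = 1 then 0 else 1) ∧
  (∀ h : H,
      {p : H × H | p.1 ∈ T₀ ∧ p.2 ∈ T₀ ∧ p.1 * p.2 = h}.ncard
        + {p : H × H | p.1 ∈ T₁ ∧ p.2 ∈ T₁ ∧ p.1 * p.2 = h}.ncard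
        + {t : H | t ∈ T₀ ∧ t ^ 2 = h}.ncard
        + {t : H | t ∈ T₁ ∧ t ^ 2 = h}.ncard
        = 2 + if h = 1 then 2 * n else 0)

/-- `Xset T₀ T₁ i` is the set of `h ∈ H` appearing with coefficient `i` in `T̂⁽²⁾T₀`. -/
def Xset {H : Type*} [CommGroup H] (T₀ T₁ : Set H) (i : ℕ) : Set H :=
  {h : H | {p : H × H | p.1 ∈ T₀ ∪ T₁ ∧ p.2 ∈ T₀ ∧ p.1 ^ 2 * p.2 = h}.ncard = i}

/-- `Yset T₀ T₁ i` is the set of `h ∈ H` appearing with coefficient `i` in `T̂⁽²⁾T₁`. -/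
def Yset {H : Type*} [CommGroup H] (T₀ T₁ : Set H) (i : ℕ) : Set H :=
  {h : H | {p : H × H | p.1 ∈ T₀ ∪ T₁ ∧ p.2 ∈ T₁ ∧ p.1 ^ 2 * p.2 = h}.ncard = i}

/-- `Vset T₀ T₁ i` is the set of `h ∈ H` appearing with coefficient `i` in `T̂⁽⁴⁾T₁`. -/
def Vset {H : Type*} [CommGroup H] (T₀ T₁ : Set H) (i : ℕ) : Set H :=
  {h : H | {p : H × H | p.1 ∈ T₀ ∪ T₁ ∧ p.2 ∈ T₁ ∧ p.1 ^ 4 * p.2 = h}.ncard = i}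

/-- `θ₀ = |(T₀T₀ ∖ T₀⁽²⁾) ∩ T̂⁽⁴⁾|`. -/
noncomputable def theta0 {H : Type*} [CommGroup H] (T₀ T₁ : Set H) : ℕ :=
  (((T₀ * T₀) \ ((fun t => t ^ 2) '' T₀)) ∩ ((fun g => g ^ 4) '' (T₀ ∪ T₁))).ncard

/-- `θ₁ = |T₁ ∩ T̂⁽²⁾|/2 + |(T₁T₁ ∖ (T₁⁽²⁾ ∪ {e})) ∩ T̂⁽⁴⁾|`, as a rational number. -/
noncomputable def theta1 {H : Type*} [CommGroup H] (T₀ T₁ : Set H) : ℚ :=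
  ((T₁ ∩ ((fun g => g ^ 2) '' (T₀ ∪ T₁))).ncard : ℚ) / 2
    + ((((T₁ * T₁) \ (((fun t => t ^ 2) '' T₁) ∪ {1}))
        ∩ ((fun g => g ^ 4) '' (T₀ ∪ T₁))).ncard : ℚ)

/-- `s_i = (i−1)(i−4)/2` if `i ≡ 1 (mod 3)`, and `(i−2)(i−3)/2` otherwise. -/
def sCoef (i : ℕ) : ℚ :=
  if i % 3 = 1 then ((i : ℚ) - 1) * ((i : ℚ) - 4) / 2
  else ((i : ℚ) - 2) * ((i : ℚ) - 3) / 2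

section PowSum

open MonoidAlgebra Finset

variable {H : Type*} [CommGroup H]

/-- The group-ring element `S^{(k)} = ∑_{t ∈ S} t^k`. -/
noncomputable def powSum (R : Type*) [CommRing R] (S : Finset H) (k : ℕ) : MonoidAlgebra R H :=
  ∑ t ∈ S, MonoidAlgebra.of R H (t ^ k)

variable {R : Type*} [CommRing R]

theorem coeff_powSum (S : Finset H) (k : ℕ) (h : H) :
    (powSum R S k).coeff h = (#{t ∈ S | t ^ k = h} : R) := by
  simp [powSum, coeff_sum, Finsupp.single_apply]

theorem coeff_powSum_mul (S S' : Finset H) (k l : ℕ) (h : H) :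
    (powSum R S k * powSum R S' l).coeff h = (#{p ∈ S ×ˢ S' | p.1 ^ k * p.2 ^ l = h} : R) := by
  rw [powSum, powSum, Finset.sum_mul_sum, ← Finset.sum_product']
  simp [coeff_sum, Finsupp.single_apply]

theorem powSum_mul_coeff_one (S : Finset H) (k : ℕ) (x : MonoidAlgebra R H) :
    (powSum R S k * x).coeff 1 = ∑ t ∈ S, x.coeff (t ^ k)⁻¹ := by
  simp [powSum, Finset.sum_mul, coeff_sum]

theorem mapDomain_powSum (S : Finset H) (k m : ℕ) :
    mapDomainRingHom R (powMonoidHom m : H →* H) (powSum R S k) = powSum R S (k * m) := by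
  simp [powSum, pow_mul]

theorem powSum_union {S S' : Finset H} (h : Disjoint S S') (k : ℕ) :
    powSum R (S ∪ S') k = powSum R S k + powSum R S' k :=
  Finset.sum_union h

theorem powSum_one_pow_three (S : Finset H) :
    powSum (ZMod 3) S 1 ^ 3 = powSum (ZMod 3) S 3 := by
  have : Fact (Nat.Prime 3) := ⟨Nat.prime_three⟩
  have : CharP (MonoidAlgebra (ZMod 3) H) 3 :=
    charP_of_injective_algebraMap (FaithfulSMul.algebraMap_injective (ZMod 3) _) 3
  rw [powSum, sum_pow_char 3]
  simp [powSum]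

theorem coeff_powSum_mul_inv {S S' : Finset H} (hS : ∀ t ∈ S, t⁻¹ ∈ S) (hS' : ∀ t ∈ S', t⁻¹ ∈ S')
    (k l : ℕ) (h : H) :
    (powSum R S k * powSum R S' l).coeff h⁻¹ = (powSum R S k * powSum R S' l).coeff h := by
  rw [coeff_powSum_mul, coeff_powSum_mul]
  congr 1
  refine Finset.card_nbij' (fun p ↦ p⁻¹) (fun p ↦ p⁻¹) ?_ ?_ (fun _ _ ↦ inv_inv _)
    (fun _ _ ↦ inv_inv _) <;>
  · intro p hp
    simp only [coe_filter, mem_product, Set.mem_ofPred_eq] at hp ⊢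
    exact ⟨⟨hS _ hp.1.1, hS' _ hp.1.2⟩, by simp [← mul_inv, hp.2]⟩

variable [Fintype H]

theorem powSum_mul_univ (S : Finset H) (k : ℕ) :
    powSum R S k * powSum R univ 1 = (#S : MonoidAlgebra R H) * powSum R univ 1 := by
  have key (t : H) : MonoidAlgebra.of R H t * powSum R univ 1 = powSum R univ 1 := by
    simp only [powSum, Finset.mul_sum, ← map_mul, pow_one]
    exact Fintype.sum_equiv (Equiv.mulLeft t) _ _ fun _ ↦ rfl
  rw [powSum, Finset.sum_mul, Finset.sum_congr rfl fun t _ ↦ key _, Finset.sum_const,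
    nsmul_eq_mul]

theorem coeff_powSum_univ (h : H) : (powSum R (univ : Finset H) 1).coeff h = 1 := by
  rw [coeff_powSum]
  rw [show ({t | t ^ 1 = h} : Finset H) = {h} by ext; simp, Finset.card_singleton, Nat.cast_one]

theorem powSum_univ_of_coprime {m : ℕ} (hm : (Nat.card H).Coprime m) :
    powSum R (univ : Finset H) m = powSum R univ 1 :=
  Fintype.sum_equiv (powCoprime hm) _ _ fun _ ↦ by simp

/-- The sum of all coefficients of a product of power sums. -/
theorem sum_coeff_powSum_mul (S S' : Finset H) (k l : ℕ) :
    ∑ h, (powSum R S k * powSum R S' l).coeff h = (#S * #S' : R) := by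
  simp_rw [coeff_powSum_mul]
  rw [← Nat.cast_sum, ← Nat.cast_mul, ← Finset.card_product,
    Finset.card_eq_sum_card_fiberwise (f := fun p : H × H ↦ p.1 ^ k * p.2 ^ l) (t := univ)
      (by simp)]

theorem sq_coeff_one (x : MonoidAlgebra R H) :
    (x * x).coeff 1 = ∑ h, x.coeff h * x.coeff h⁻¹ := by
  rw [coeff_mul, Finsupp.sum_fintype _ _ (by simp)]
  refine Finset.sum_congr rfl fun h _ ↦ ?_
  rw [Finsupp.sum_fintype _ _ (by simp)]
  simp [mul_eq_one_iff_eq_inv']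

end PowSum

section APLL

open MonoidAlgebra Finset

variable {H : Type*} [CommGroup H] [Fintype H] {n : ℕ} {A B : Finset H}

/-- The APLL equations for finsets. -/
structure IsAPLLPair (n : ℕ) (A B : Finset H) : Prop where
  card_univ : Fintype.card H = n ^ 2 + n + 1
  inv_left : ∀ t ∈ A, t⁻¹ ∈ A
  inv_right : ∀ t ∈ B, t⁻¹ ∈ B
  one_mem : 1 ∈ A
  card_add : #A + #B = 2 * n + 1
  mul_eq (h : H) : #{p ∈ A ×ˢ B | p.1 * p.2 = h} = if h = 1 then 0 else 1
  sq_eq (h : H) : #{p ∈ A ×ˢ A | p.1 * p.2 = h} + #{p ∈ B ×ˢ B | p.1 * p.2 = h}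
    + #{t ∈ A | t ^ 2 = h} + #{t ∈ B | t ^ 2 = h} = 2 + if h = 1 then 2 * n else 0

namespace IsAPLLPair

theorem powSum_mul (hp : IsAPLLPair n A B) (R : Type*) [CommRing R] :
    powSum R A 1 * powSum R B 1 = powSum R univ 1 - 1 := by
  ext h
  have := congrArg (Nat.cast (R := R)) (hp.mul_eq h)
  rw [coeff_powSum_mul]
  simp only [pow_one, this, coeff_sub, Finsupp.sub_apply, coeff_powSum_univ, one_def, coeff_single,
    Finsupp.single_apply, eq_comm (a := (1 : H))]
  split_ifs <;> simp

theorem powSum_sq (hp : IsAPLLPair n A B) (R : Type*) [CommRing R] :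
    powSum R A 1 * powSum R A 1 + powSum R B 1 * powSum R B 1 + powSum R A 2 + powSum R B 2
      = 2 * powSum R univ 1 + 2 * (n : MonoidAlgebra R H) := by
  ext h
  have := congrArg (Nat.cast (R := R)) (hp.sq_eq h)
  rw [show 2 * powSum R univ 1 + 2 * (n : MonoidAlgebra R H)
    = powSum R univ 1 + powSum R univ 1 + ((2 * n : ℕ) : MonoidAlgebra R H) by push_cast; ring]
  simp only [coeff_add, Finsupp.add_apply, coeff_powSum_univ, coeff_natCast, Finsupp.single_apply]
  simp only [coeff_powSum_mul, coeff_powSum, pow_one, eq_comm (a := (1 : H))]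
  push_cast at this
  rw [this]
  split_ifs <;> norm_num

theorem disjoint (hp : IsAPLLPair n A B) : Disjoint A B := by
  refine Finset.disjoint_left.2 fun t ha hb ↦ ?_
  have := hp.mul_eq 1
  rw [if_pos rfl, Finset.card_eq_zero] at this
  have hm : (t⁻¹, t) ∈ ({p ∈ A ×ˢ B | p.1 * p.2 = 1} : Finset (H × H)) := by
    simp [hp.inv_left t ha, hb]
  simp [this] at hm

theorem odd_card_univ (hp : IsAPLLPair n A B) : Odd (Fintype.card H) := by
  rw [hp.card_univ, Nat.odd_iff]
  have := Nat.even_mul_succ_self n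
  rw [Nat.even_iff] at this
  have e : n ^ 2 + n = n * (n + 1) := by ring
  omega

theorem coprime_two (hp : IsAPLLPair n A B) : (Nat.card H).Coprime 2 := by
  rw [Nat.card_eq_fintype_card, Nat.coprime_two_right]
  exact hp.odd_card_univ

theorem odd_card_left (hp : IsAPLLPair n A B) : Odd #A := by
  have key : ∑ t ∈ A.erase 1, (1 : ZMod 2) = 0 := by
    refine Finset.sum_involution (fun t _ ↦ t⁻¹) (fun _ _ ↦ by decide) (fun t ht _ h ↦ ?_)
      (fun t ht ↦ ?_) (fun t _ ↦ inv_inv t)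
    · refine (Finset.mem_erase.1 ht).1 ((powCoprime hp.coprime_two).injective ?_)
      simpa [sq, mul_eq_one_iff_inv_eq] using h
    · simpa using ⟨(Finset.mem_erase.1 ht).1, hp.inv_left t (Finset.mem_erase.1 ht).2⟩
  rw [Finset.sum_const, nsmul_one, ZMod.natCast_eq_zero_iff_even] at key
  rw [← Finset.card_erase_add_one hp.one_mem]
  exact key.add_one

theorem card_left (hp : IsAPLLPair n A B) (hn : Odd n) : #A = n := by
  have h : (#A * #B : ℤ) = n ^ 2 + n := by
    rw [← sum_coeff_powSum_mul A B 1 1, hp.powSum_mul]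
    simp [coeff_powSum_univ, one_def, hp.card_univ]
  have hs : (#A + #B : ℤ) = 2 * n + 1 := mod_cast hp.card_add
  have : ((#A : ℤ) - n) * (#A - (n + 1)) = 0 := by
    linear_combination -h + (#A : ℤ) * hs
  have ho := hp.odd_card_left
  rw [Nat.odd_iff] at ho hn
  rcases mul_eq_zero.1 this with h | h <;> omega

theorem card_right (hp : IsAPLLPair n A B) (hn : Odd n) : #B = n + 1 := by
  have := hp.card_add
  have := hp.card_left hn
  omega

theorem powSum_union_two_mul (hp : IsAPLLPair n A B) (hn : Odd n) (R : Type*) [CommRing R] :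
    powSum R (A ∪ B) 2 * powSum R A 1
      = ((n : MonoidAlgebra R H) - 1) * powSum R univ 1 - powSum R A 1 ^ 3 + powSum R B 1
        + 2 * (n : MonoidAlgebra R H) * powSum R A 1 := by
  have hA := powSum_mul_univ (R := R) A 1
  have hB := powSum_mul_univ (R := R) B 1
  rw [hp.card_left hn] at hA
  rw [hp.card_right hn] at hB
  push_cast at hB
  rw [powSum_union hp.disjoint]
  linear_combination powSum R A 1 * hp.powSum_sq R - powSum R B 1 * hp.powSum_mul R + 2 * hA - hB

theorem powSum_union_two_sq (hp : IsAPLLPair n A B) (R : Type*) [CommRing R] :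
    powSum R (A ∪ B) 2 * powSum R (A ∪ B) 2
      = 4 * powSum R univ 1 - powSum R (A ∪ B) 4 + (2 * (n : MonoidAlgebra R H) - 2) := by
  have h : powSum R (A ∪ B) 1 * powSum R (A ∪ B) 1
      = 4 * powSum R univ 1 - powSum R (A ∪ B) 2 + (2 * (n : MonoidAlgebra R H) - 2) := by
    simp only [powSum_union hp.disjoint]
    linear_combination hp.powSum_sq R + 2 * hp.powSum_mul R
  have := congrArg (mapDomainRingHom R (powMonoidHom 2 : H →* H)) h
  simpa only [map_mul, map_add, map_sub, map_ofNat, map_natCast, mapDomain_powSum, one_mul,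
    powSum_univ_of_coprime hp.coprime_two] using this

theorem three_dvd_coeff (hp : IsAPLLPair n A B) (hn : Odd n) (hn3 : n % 3 = 1) {h : H}
    (hA : h ∉ A) (hB : h ∉ B) (hC : h ∉ A.image (· ^ 3)) :
    (3 : ℤ) ∣ (powSum ℤ (A ∪ B) 2 * powSum ℤ A 1).coeff h := by
  have hnz : (n : MonoidAlgebra (ZMod 3) H) = 1 := by
    have : (n : ZMod 3) = 1 := by
      rw [← Nat.cast_one, ZMod.natCast_eq_natCast_iff]
      exact hn3
    rw [natCast_def, this, one_def]
  have key := congrArg (fun x ↦ x.coeff h) (hp.powSum_union_two_mul hn (ZMod 3))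
  have hA' : #{t ∈ A | t ^ 1 = h} = 0 := by
    rw [Finset.card_eq_zero, Finset.filter_eq_empty_iff]
    rintro t ht rfl
    simp_all
  have hB' : #{t ∈ B | t ^ 1 = h} = 0 := by
    rw [Finset.card_eq_zero, Finset.filter_eq_empty_iff]
    rintro t ht rfl
    simp_all
  have hC' : #{t ∈ A | t ^ 3 = h} = 0 := by
    rw [Finset.card_eq_zero, Finset.filter_eq_empty_iff]
    exact fun t ht e ↦ hC (Finset.mem_image.2 ⟨t, ht, e⟩)
  rw [hnz, powSum_one_pow_three, sub_self, zero_mul, zero_sub, mul_one, two_mul] at key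
  simp only [coeff_add, coeff_neg, Finsupp.add_apply, Finsupp.neg_apply, coeff_powSum, hA', hB', hC',
    coeff_powSum_mul] at key
  rw [coeff_powSum_mul]
  exact_mod_cast (ZMod.natCast_eq_zero_iff _ 3).1 (by rw [key]; simp)

theorem coeff_sq_one (hp : IsAPLLPair n A B) :
    (powSum ℤ A 1 * powSum ℤ A 1).coeff 1 = #A := by
  rw [powSum_mul_coeff_one, Finset.sum_congr rfl (g := fun _ ↦ (1 : ℤ)), Finset.sum_const,
    nsmul_one]
  intro t ht
  rw [coeff_powSum]
  rw [show ({s ∈ A | s ^ 1 = (t ^ 1)⁻¹} : Finset H) = {t⁻¹} by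
    ext s; simp +contextual [hp.inv_left t ht]]
  simp

/-- The elements `g ∈ A ∪ B` whose fourth power lies in `AA` but not in `A^{(2)}`. -/
noncomputable def fourthPowers (A B : Finset H) : Finset H :=
  {g ∈ A ∪ B | (∃ a ∈ A, ∃ b ∈ A, a * b = g ^ 4) ∧ ∀ a ∈ A, a ^ 2 ≠ g ^ 4}

theorem two_le_coeff_sq {g : H} (hg : g ∈ fourthPowers A B) :
    2 ≤ (powSum ℤ A 1 * powSum ℤ A 1).coeff (g ^ 4) := by
  obtain ⟨-, ⟨a, ha, b, hb, hab⟩, hsq⟩ := Finset.mem_filter.1 hg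
  rw [coeff_powSum_mul]
  norm_cast
  refine Finset.one_lt_card.2 ⟨(a, b), by simp [*], (b, a), by simp [*, mul_comm b a], ?_⟩
  intro h
  obtain rfl : a = b := congrArg Prod.fst h
  exact hsq a ha (by rw [sq, hab])

theorem le_coeff_four_mul (hp : IsAPLLPair n A B) :
    (#A + 2 * #(fourthPowers A B) : ℤ)
      ≤ (powSum ℤ (A ∪ B) 4 * (powSum ℤ A 1 * powSum ℤ A 1)).coeff 1 := by
  have h1 : 1 ∉ fourthPowers A B := fun h ↦
    (Finset.mem_filter.1 h).2.2 1 hp.one_mem (by simp)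
  have hsub : insert 1 (fourthPowers A B) ⊆ A ∪ B := by
    refine Finset.insert_subset (Finset.mem_union_left _ hp.one_mem) (Finset.filter_subset _ _)
  rw [powSum_mul_coeff_one]
  simp_rw [coeff_powSum_mul_inv hp.inv_left hp.inv_left]
  refine le_trans ?_ (Finset.sum_le_sum_of_subset_of_nonneg hsub fun g _ _ ↦ ?_)
  · rw [Finset.sum_insert h1, one_pow, hp.coeff_sq_one]
    have := Finset.card_nsmul_le_sum (fourthPowers A B)
      (fun g ↦ (powSum ℤ A 1 * powSum ℤ A 1).coeff (g ^ 4)) 2 fun g hg ↦ two_le_coeff_sq hg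
    rw [nsmul_eq_mul] at this
    linarith
  · rw [coeff_powSum_mul]
    positivity

theorem sum_coeff_mul_sub_three_le (hp : IsAPLLPair n A B) (hn : Odd n) :
    ∑ h, (powSum ℤ (A ∪ B) 2 * powSum ℤ A 1).coeff h
        * ((powSum ℤ (A ∪ B) 2 * powSum ℤ A 1).coeff h - 3)
      ≤ -(6 * n + 2 * #(fourthPowers A B)) := by
  set c := powSum ℤ (A ∪ B) 2 * powSum ℤ A 1 with hc
  have hT : ∀ t ∈ A ∪ B, t⁻¹ ∈ A ∪ B := by
    intro t ht
    rcases Finset.mem_union.1 ht with ht | ht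
    · exact Finset.mem_union_left _ (hp.inv_left t ht)
    · exact Finset.mem_union_right _ (hp.inv_right t ht)
  have hA := hp.card_left hn
  have hsum : ∑ h, c.coeff h = (2 * n + 1) * n := by
    rw [hc, sum_coeff_powSum_mul, Finset.card_union_of_disjoint hp.disjoint, hp.card_add, hA]
    push_cast
    rfl
  have hsq : ∑ h, c.coeff h * c.coeff h = (c * c).coeff 1 := by
    rw [sq_coeff_one]
    refine Finset.sum_congr rfl fun h _ ↦ ?_
    rw [hc, coeff_powSum_mul_inv hT hp.inv_left]
  have hU := powSum_mul_univ (R := ℤ) A 1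
  rw [hA] at hU
  have hcc : c * c = ((4 * n ^ 2 : ℕ) : MonoidAlgebra ℤ H) * powSum ℤ univ 1
      - powSum ℤ (A ∪ B) 4 * (powSum ℤ A 1 * powSum ℤ A 1)
      + ((2 * n : ℕ) : MonoidAlgebra ℤ H) * (powSum ℤ A 1 * powSum ℤ A 1)
      - (powSum ℤ A 1 * powSum ℤ A 1) - (powSum ℤ A 1 * powSum ℤ A 1) := by
    push_cast
    linear_combination powSum ℤ A 1 * powSum ℤ A 1 * hp.powSum_union_two_sq ℤ
      + 4 * (powSum ℤ A 1 + (n : MonoidAlgebra ℤ H)) * hU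
  have hcoeff : (c * c).coeff 1 = 4 * n ^ 2
      - (powSum ℤ (A ∪ B) 4 * (powSum ℤ A 1 * powSum ℤ A 1)).coeff 1 + 2 * n * n - n - n := by
    have h2 := hp.coeff_sq_one
    rw [hA] at h2
    rw [hcc]
    simp only [← nsmul_eq_mul, coeff_add, coeff_sub, Finsupp.add_apply, Finsupp.sub_apply,
      coeff_smul, Finsupp.smul_apply, h2, coeff_powSum_univ]
    simp
  have hle := hp.le_coeff_four_mul
  rw [hA] at hle
  simp_rw [mul_sub, Finset.sum_sub_distrib, ← Finset.sum_mul]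
  rw [hsq, hsum, hcoeff]
  linarith

theorem card_support_ge (hp : IsAPLLPair n A B) (hn : Odd n) (hn3 : n % 3 = 1) :
    3 * n + #(fourthPowers A B) ≤ #(A ∪ (B ∪ (A.image (· ^ 3)).erase 1)) := by
  set S := A ∪ (B ∪ (A.image (· ^ 3)).erase 1) with hS
  have hle : ∑ h, (if h ∈ S then (-2 : ℤ) else 0)
      ≤ ∑ h, (powSum ℤ (A ∪ B) 2 * powSum ℤ A 1).coeff h
        * ((powSum ℤ (A ∪ B) 2 * powSum ℤ A 1).coeff h - 3) := by
    refine Finset.sum_le_sum fun h _ ↦ ?_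
    split_ifs with hh
    · generalize (powSum ℤ (A ∪ B) 2 * powSum ℤ A 1).coeff h = x
      rcases le_or_gt x 1 with hx | hx <;> nlinarith
    · simp only [hS, Finset.mem_union, Finset.mem_erase, not_or, not_and] at hh
      have h1 : h ≠ 1 := fun e ↦ hh.1 (e ▸ hp.one_mem)
      obtain ⟨y, hy⟩ := hp.three_dvd_coeff hn hn3 hh.1 hh.2.1 (hh.2.2 h1)
      rw [hy]
      rcases le_or_gt y 0 with hx | hx <;> nlinarith
  have := hle.trans (hp.sum_coeff_mul_sub_three_le hn)
  simp at this
  omega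

theorem disjoint_image_cube (hp : IsAPLLPair n A B) (hn : Odd n) (hn3 : n % 3 = 1) :
    Disjoint B (A.image (· ^ 3)) ∧ fourthPowers A B = ∅ ∧ Set.InjOn (fun t : H ↦ t ^ 3) A := by
  have hge := hp.card_support_ge hn hn3
  have h1 : (1 : H) ∈ A.image (· ^ 3) := Finset.mem_image.2 ⟨1, hp.one_mem, one_pow 3⟩
  have hC := Finset.card_erase_add_one h1
  have hCA : #(A.image (· ^ 3)) ≤ #A := Finset.card_image_le
  have hu := Finset.card_union_le A (B ∪ (A.image (· ^ 3)).erase 1)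
  have hu' := Finset.card_union_le B ((A.image (· ^ 3)).erase 1)
  have hA := hp.card_left hn
  have hB := hp.card_right hn
  refine ⟨?_, Finset.card_eq_zero.1 (by omega), Finset.card_image_iff.1 (by omega)⟩
  have hd : Disjoint B ((A.image (· ^ 3)).erase 1) :=
    Finset.card_union_eq_card_add_card.1 (by omega)
  rw [← Finset.insert_erase h1, Finset.disjoint_insert_right]
  exact ⟨Finset.disjoint_left.1 hp.disjoint hp.one_mem, hd⟩

end IsAPLLPair

end APLL

/-- For `n ≡ 1 (mod 6)`: `T₁ ∩ T₀⁽³⁾ = ∅`, `θ₀ = 0`, and `Δ₀ ⊆ T₁`, where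
`Δ₀` is the set of elements appearing twice in `T₀⁽³⁾`. -/
theorem delta0_n_eq_one_mod_six (n : ℕ) (hn : 0 < n) (hmod : n % 6 = 1)
    {H : Type*} [CommGroup H] [Fintype H]
    (hcard : Fintype.card H = n ^ 2 + n + 1)
    (T₀ T₁ : Set H) (hT₀inv : T₀⁻¹ = T₀) (hT₁inv : T₁⁻¹ = T₁)
    (he : (1 : H) ∈ T₀) (hk : T₀.ncard + T₁.ncard = 2 * n + 1)
    (hAPLL : APLLEqs n T₀ T₁) :
    T₁ ∩ ((fun t => t ^ 3) '' T₀) = ∅ ∧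
    theta0 T₀ T₁ = 0 ∧
    {h : H | {t : H | t ∈ T₀ ∧ t ^ 3 = h}.ncard = 2} ⊆ T₁ := by
  have hp : IsAPLLPair n T₀.toFinset T₁.toFinset := by
    refine ⟨hcard, fun t ht ↦ ?_, fun t ht ↦ ?_, by simpa using he, ?_, fun h ↦ ?_, fun h ↦ ?_⟩
    · rw [Set.mem_toFinset] at ht ⊢
      exact hT₀inv ▸ Set.inv_mem_inv.2 ht
    · rw [Set.mem_toFinset] at ht ⊢
      exact hT₁inv ▸ Set.inv_mem_inv.2 ht
    · rw [← hk, Set.ncard_eq_toFinset_card', Set.ncard_eq_toFinset_card']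
    · rw [← hAPLL.1 h, ← Set.ncard_coe_finset]
      congr 1
      ext
      simp [and_assoc]
    · rw [← hAPLL.2 h]
      simp only [← Set.ncard_coe_finset, Finset.coe_filter, Finset.mem_product, Set.mem_toFinset,
        and_assoc]
  obtain ⟨hd, hf, hi⟩ := hp.disjoint_image_cube (by rw [Nat.odd_iff]; omega) (by omega)
  refine ⟨?_, ?_, fun h hh ↦ ?_⟩
  · rw [← Set.disjoint_iff_inter_eq_empty]
    simpa [← Finset.disjoint_coe] using hd
  · rw [theta0, Set.ncard_eq_zero, Set.eq_empty_iff_forall_notMem]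
    rintro x ⟨⟨⟨a, ha, b, hb, hab⟩, hx⟩, g, hg, rfl⟩
    have : g ∈ IsAPLLPair.fourthPowers T₀.toFinset T₁.toFinset := by
      simp only [IsAPLLPair.fourthPowers, Finset.mem_filter, Finset.mem_union, Set.mem_toFinset]
      exact ⟨hg, ⟨a, ha, b, hb, hab⟩, fun a ha e ↦ hx ⟨a, ha, e⟩⟩
    simp [hf] at this
  · have hle : {t : H | t ∈ T₀ ∧ t ^ 3 = h}.ncard ≤ 1 := by
      rw [Set.ncard_le_one]
      exact fun a ha b hb ↦ hi (by simpa using ha.1) (by simpa using hb.1) (ha.2.trans hb.2.symm)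
    have : {t : H | t ∈ T₀ ∧ t ^ 3 = h}.ncard = 2 := hh
    omega
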